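/- Suppose in addition that $\varepsilon\in(0,1)$ and $\delta=\varepsilon\,(2\pi/\ln(1/\varepsilon))^{(p-1)/2}$. Then $\displaystyle\frac{(\ln(1/\varepsilon))^{p}}{(2\pi)^{p}\,\varepsilon^{2}}\int_{B_s(0)}\bigl(W(|x|)-a\bigr)_+^{\,p}\,dx=\frac{a\,\ln(1/\varepsilon)}{\ln(R/s)}$. -/

import Mathlib

open Real Set MeasureTheory

/-- Integration in polar coordinates of a radial function over a disc. -/
theorem integral_ball_radial_fin_two (f : ℝ → ℝ) {s : ℝ} (hs : 0 ≤ s) :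
    ∫ x in Metric.ball (0 : EuclideanSpace ℝ (Fin 2)) s, f ‖x‖ =
      2 * π * ∫ r in (0 : ℝ)..s, r * f r := by
  have hind : ∀ x : EuclideanSpace ℝ (Fin 2),
      (Metric.ball (0 : EuclideanSpace ℝ (Fin 2)) s).indicator (fun x => f ‖x‖) x =
        (Iio s).indicator f ‖x‖ := fun x => by simp [indicator]
  have hvol : (volume : Measure (EuclideanSpace ℝ (Fin 2))).real (Metric.ball 0 1) = π := by
    simp [Measure.real, pi_pos.le]
  rw [← integral_indicator measurableSet_ball, funext hind,
    integral_fun_norm_addHaar volume ((Iio s).indicator f), hvol,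
    intervalIntegral.integral_of_le hs, integral_Ioc_eq_integral_Ioo]
  have hprod : ∀ y : ℝ, y ^ (Module.finrank ℝ (EuclideanSpace ℝ (Fin 2)) - 1) •
      (Iio s).indicator f y = (Iio s).indicator (fun r => r * f r) y := fun y => by
    by_cases hy : y < s <;> simp [hy]
  simp_rw [hprod]
  rw [setIntegral_indicator measurableSet_Iio, Ioi_inter_Iio]
  simp [mul_assoc]

/-- Flux identity for the radial Lane–Emden equation on the unit disc. -/
theorem integral_mul_rpow_of_laneEmden {p : ℝ} (hp : 0 ≤ p) {φ φ' φ'' : ℝ → ℝ}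
    (hφ : ContinuousOn φ (Icc (0 : ℝ) 1)) (hφ' : ContinuousOn φ' (Icc (0 : ℝ) 1))
    (hd : ∀ r ∈ Ioo (0 : ℝ) 1, HasDerivAt φ' (φ'' r) r)
    (hode : ∀ r ∈ Ioo (0 : ℝ) 1, φ'' r + (1 / r) * φ' r + φ r ^ p = 0) :
    ∫ r in (0 : ℝ)..1, r * φ r ^ p = -φ' 1 := by
  have hderiv : ∀ r ∈ Ioo (0 : ℝ) 1, HasDerivAt (fun r => -(r * φ' r)) (r * φ r ^ p) r := by
    intro r hr
    refine ((hasDerivAt_id' r).mul (hd r hr)).neg.congr_deriv ?_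
    have hr0 : r ≠ 0 := hr.1.ne'
    have h := hode r hr
    field_simp at h
    linear_combination -h
  have hint : IntervalIntegrable (fun r => r * φ r ^ p) volume 0 1 := by
    refine ContinuousOn.intervalIntegrable ?_
    rw [uIcc_of_le zero_le_one]
    exact continuousOn_id.mul (hφ.rpow_const fun _ _ => Or.inr hp)
  rw [intervalIntegral.integral_eq_sub_of_hasDerivAt_of_le zero_le_one
    (continuousOn_id.mul hφ').neg hderiv hint]
  simp

/-- With `δ = ε (2π/log(1/ε))^{(p-1)/2}`, the rescaled circulation
of one regularized vortex is
`(log(1/ε))^p / ((2π)^p ε²) · ∫_{B_s(0)} (W(|x|) - a)₊^p dx = a log(1/ε) / log(R/s)`. -/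
theorem rescaled_circulation (p : ℝ) (hp : 1 < p) (φ φ' φ'' : ℝ → ℝ)
    (hd1 : ∀ r ∈ Icc (0 : ℝ) 1, HasDerivWithinAt φ (φ' r) (Icc (0 : ℝ) 1) r)
    (hd1c : ContinuousOn φ' (Icc (0 : ℝ) 1))
    (hd2 : ∀ r ∈ Ioo (0 : ℝ) 1, HasDerivAt φ' (φ'' r) r)
    (hpos : ∀ r ∈ Ico (0 : ℝ) 1, 0 < φ r) (hφ1 : φ 1 = 0)
    (hode : ∀ r ∈ Ioo (0 : ℝ) 1, φ'' r + (1 / r) * φ' r + φ r ^ p = 0)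
    (R a s ε δ : ℝ) (hR : 0 < R) (ha : 0 < a) (hs : s ∈ Ioo (0 : ℝ) R)
    (hε : ε ∈ Ioo (0 : ℝ) 1)
    (hδ : δ = ε * (2 * π / Real.log (1 / ε)) ^ ((p - 1) / 2))
    (hmatch : δ ^ (2 / (p - 1)) * s ^ (-(2 / (p - 1))) * φ' 1 = a / Real.log (s / R))
    (W : ℝ → ℝ)
    (hW : ∀ r : ℝ, W r =
      if r ≤ s then a + δ ^ (2 / (p - 1)) * s ^ (-(2 / (p - 1))) * φ (r / s)
      else a * Real.log (r / R) / Real.log (s / R)) :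
    (Real.log (1 / ε)) ^ p / ((2 * π) ^ p * ε ^ 2) *
        (∫ x in Metric.ball (0 : EuclideanSpace ℝ (Fin 2)) s, max (W ‖x‖ - a) 0 ^ p)
      = a * Real.log (1 / ε) / Real.log (R / s) := by
  have hs0 : 0 < s := hs.1
  have hp1 : p - 1 ≠ 0 := by linarith
  have hL : 0 < Real.log (1 / ε) := Real.log_pos ((one_lt_div hε.1).2 hε.2)
  have hq : 0 < 2 * π / Real.log (1 / ε) := by positivity
  have hδ0 : 0 < δ := hδ ▸ mul_pos hε.1 (rpow_pos_of_pos hq _)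
  have hflux := integral_mul_rpow_of_laneEmden (by linarith : (0 : ℝ) ≤ p)
    (fun r hr => (hd1 r hr).continuousWithinAt) hd1c hd2 hode
  set c := δ ^ (2 / (p - 1)) * s ^ (-(2 / (p - 1))) with hc
  have hc0 : 0 < c := by positivity
  have hcp : c ^ p * s ^ 2 = c * δ ^ 2 := by
    have hpow : c ^ (p - 1) = δ ^ 2 * (s ^ 2)⁻¹ := by
      rw [hc, mul_rpow (by positivity) (by positivity), ← rpow_mul hδ0.le, ← rpow_mul hs0.le,
        neg_mul, div_mul_cancel₀ _ hp1, rpow_neg hs0.le, rpow_two, rpow_two]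
    rw [← add_sub_cancel 1 p, rpow_add hc0, rpow_one, hpow]
    field_simp
  have hδ2 : δ ^ 2 = ε ^ 2 * ((2 * π) ^ p / Real.log (1 / ε) ^ p) *
      (Real.log (1 / ε) / (2 * π)) := by
    rw [hδ, mul_pow, ← rpow_two (_ ^ _), ← rpow_mul hq.le, div_mul_cancel₀ _ two_ne_zero,
      rpow_sub_one hq.ne', div_rpow (by positivity) hL.le]
    field_simp
  have hint : ∫ r in (0 : ℝ)..s, r * max (W r - a) 0 ^ p = s ^ 2 * c ^ p * -φ' 1 := by
    have hcongr : ∀ r ∈ uIcc 0 s,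
        r * max (W r - a) 0 ^ p = s * c ^ p * (r / s * φ (r / s) ^ p) := by
      intro r hr
      rw [uIcc_of_le hs0.le] at hr
      have hφ0 : 0 ≤ φ (r / s) := by
        rcases ((div_le_one hs0).2 hr.2).lt_or_eq with h | h
        · exact (hpos _ ⟨div_nonneg hr.1 hs0.le, h⟩).le
        · rw [h, hφ1]
      rw [hW, if_pos hr.2, add_sub_cancel_left, max_eq_left (by positivity),
        mul_rpow hc0.le hφ0]
      field_simp
    rw [intervalIntegral.integral_congr hcongr, intervalIntegral.integral_const_mul,
      intervalIntegral.integral_comp_div (fun t => t * φ t ^ p) hs0.ne', zero_div,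
      div_self hs0.ne', hflux, smul_eq_mul]
    ring
  have hlog : Real.log (s / R) = -Real.log (R / s) := by rw [← Real.log_inv, inv_div]
  have hRs : Real.log (R / s) ≠ 0 := (Real.log_pos ((one_lt_div hs0).2 hs.2)).ne'
  have hmass : s ^ 2 * c ^ p * -φ' 1 = δ ^ 2 * (a / Real.log (R / s)) := by
    rw [hlog, div_neg] at hmatch
    linear_combination (-φ' 1) * hcp - δ ^ 2 * hmatch
  rw [integral_ball_radial_fin_two (fun r => max (W r - a) 0 ^ p) hs0.le, hint, hmass, hδ2]
  have hε0 : ε ≠ 0 := hε.1.ne'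
  have hLp : Real.log (1 / ε) ^ p ≠ 0 := (rpow_pos_of_pos hL p).ne'
  have hπp : (2 * π) ^ p ≠ 0 := (rpow_pos_of_pos (by positivity) p).ne'
  generalize Real.log (1 / ε) ^ p = A at *
  generalize (2 * π) ^ p = B at *
  field_simp
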